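/- Let n ≥ 4 and let w be a basic involution in the Weyl group W of type D_n such that Supp(w) ∩ 𝒞₁ = ∅. Then for every root α ∈ 𝒞₁ the Kostant–Kumar polynomial d_w is divisible by α in ℂ[x_1,…,x_n]; that is, for every reduced decomposition of w there exists a polynomial g ∈ ℂ[x_1,…,x_n] such that d_w = α·g in ℂ(x_1,…,x_n). -/

import Mathlib

/-!
The Weyl group of type `Dₙ`, realized as the group of permutations `w` of `ℤ`
supported on `{±1, …, ±n}` with `w (-i) = - w i` and an even number of sign changes.
-/

open Equiv

/-- The simple reflections of type `Dₙ`, indexed by `i ∈ {1, …, n}`: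
`sᵢ = (i, i+1)(-i, -(i+1))` for `1 ≤ i ≤ n - 1`, and
`sₙ = (n-1, -n)(-(n-1), n)`. -/
def simpleRefl (n : ℕ) (i : ℕ) : Equiv.Perm ℤ :=
  if i < n then Equiv.swap (i : ℤ) ((i : ℤ) + 1) * Equiv.swap (-(i : ℤ)) (-((i : ℤ) + 1))
  else Equiv.swap ((n : ℤ) - 1) (-(n : ℤ)) * Equiv.swap (-((n : ℤ) - 1)) (n : ℤ)

/-- A word in the letters `{1, …, n}` (indices of simple reflections). -/
def IsWord (n : ℕ) (L : List ℕ) : Prop := ∀ i ∈ L, 1 ≤ i ∧ i ≤ n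

/-- The product `s_{i₁} ⋯ s_{i_l}` of the word `L = [i₁, …, i_l]`. -/
def wordProd (n : ℕ) (L : List ℕ) : Equiv.Perm ℤ := (L.map (simpleRefl n)).prod

/-- Membership in the Weyl group `W` of type `Dₙ`: a permutation of `ℤ` commuting with
negation, fixing every integer of absolute value `> n`, and with an even number of
`i ∈ {1, …, n}` such that `w i < 0`. -/
def IsD (n : ℕ) (w : Equiv.Perm ℤ) : Prop :=
  (∀ i : ℤ, w (-i) = -(w i)) ∧ (∀ i : ℤ, (n : ℤ) < |i| → w i = i) ∧
    Even (((Finset.Icc (1 : ℤ) (n : ℤ)).filter fun i => w i < 0).card)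

/-- The length `ℓ(w)`: the minimal number of factors in an expression of `w` as a
product of simple reflections. -/
noncomputable def weylLength (n : ℕ) (w : Equiv.Perm ℤ) : ℕ :=
  sInf {l | ∃ L : List ℕ, IsWord n L ∧ L.length = l ∧ wordProd n L = w}

/-- `L` is a reduced decomposition of `w`. -/
def IsReducedWord (n : ℕ) (w : Equiv.Perm ℤ) (L : List ℕ) : Prop :=
  IsWord n L ∧ wordProd n L = w ∧ L.length = weylLength n w

/-- `w` is a basic involution: `w ∈ W`, `w² = id`, and `w i ≠ -i` for all `i ∈ {1, …, n}`. -/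
def IsBasicInvolution (n : ℕ) (w : Equiv.Perm ℤ) : Prop :=
  IsD n w ∧ w * w = 1 ∧ ∀ i : ℤ, 1 ≤ i → i ≤ (n : ℤ) → w i ≠ -i
open MvPolynomial

/-- The field `ℂ(x₁, …, xₙ)` of rational functions. -/
abbrev KK (n : ℕ) : Type := FractionRing (MvPolynomial (Fin n) ℂ)

/-- The linear polynomial `ε_k` for `k ∈ {±1, …, ±n}`: `ε_k = x_k` for `1 ≤ k ≤ n`
and `ε_{-k} = -ε_k` (and `0` for `k` out of range). -/
noncomputable def epsPoly (n : ℕ) (k : ℤ) : MvPolynomial (Fin n) ℂ :=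
  if h : 1 ≤ k ∧ k ≤ (n : ℤ) then X (⟨(k - 1).toNat, by omega⟩ : Fin n)
  else if h' : 1 ≤ -k ∧ -k ≤ (n : ℤ) then -X (⟨(-k - 1).toNat, by omega⟩ : Fin n)
  else 0

/-- The simple roots: `αᵢ = xᵢ - xᵢ₊₁` for `1 ≤ i ≤ n - 1` and `αₙ = xₙ₋₁ + xₙ`. -/
noncomputable def simpleRootPoly (n : ℕ) (i : ℕ) : MvPolynomial (Fin n) ℂ :=
  if i < n then epsPoly n (i : ℤ) - epsPoly n ((i : ℤ) + 1)
  else epsPoly n ((n : ℤ) - 1) + epsPoly n (n : ℤ)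

/-- The action of a signed permutation `w` on polynomials, sending `xᵢ = ε_i` to
`ε_{w(i)}` (with `1`-based indexing of the variables). -/
noncomputable def polyAct (n : ℕ) (w : Equiv.Perm ℤ) :
    MvPolynomial (Fin n) ℂ →ₐ[ℂ] MvPolynomial (Fin n) ℂ :=
  aeval fun i : Fin n => epsPoly n (w (((i : ℕ) : ℤ) + 1))

/-- The partial product `s_{i₁}^{ε₁} ⋯ s_{i_k}^{ε_k}` of a word `L` with
exponent pattern `E`. -/
def maskedPrefix (n : ℕ) (L : List ℕ) (E : ℕ → Bool) (k : ℕ) : Equiv.Perm ℤ :=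
  ((List.range k).map fun m => if E m then simpleRefl n (L.getD m 0) else 1).prod

/-- The element `c_{w,v}` computed from a word `L = [i₁, …, i_l]` for `w`:
`c_{w,v} = (-1)^l ∑ ∏_{k=1}^{l} (s_{i₁}^{ε₁} ⋯ s_{i_k}^{ε_k}(α_{i_k}))⁻¹`,
the sum over all `(ε₁, …, ε_l) ∈ {0,1}^l` with `s_{i₁}^{ε₁} ⋯ s_{i_l}^{ε_l} = v`. -/
noncomputable def cElem (n : ℕ) (L : List ℕ) (v : Equiv.Perm ℤ) : KK n := by
  classical
  exact (-1 : KK n) ^ L.length *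
    ∑ E : Fin L.length → Bool,
      if maskedPrefix n L (fun m => if h : m < L.length then E ⟨m, h⟩ else false) L.length = v then
        ∏ k ∈ Finset.range L.length,
          (algebraMap (MvPolynomial (Fin n) ℂ) (KK n)
            (polyAct n
              (maskedPrefix n L (fun m => if h : m < L.length then E ⟨m, h⟩ else false) (k + 1))
              (simpleRootPoly n (L.getD k 0))))⁻¹
      else 0

/-- The product `∏_{α ∈ Φ⁺} α` of all positive roots of `Dₙ`. -/
noncomputable def prodPosRoots (n : ℕ) : MvPolynomial (Fin n) ℂ :=
  ∏ p ∈ Finset.univ.filter (fun p : Fin n × Fin n => p.1 < p.2),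
    ((X p.1 - X p.2) * (X p.1 + X p.2))

/-- The Kostant–Kumar polynomial `d_w = (-1)^{ℓ(w)} ⬝ c_w ⬝ ∏_{α ∈ Φ⁺} α`, computed
from a word `L` for `w` (here `c_w = c_{w, id}`). -/
noncomputable def dElem (n : ℕ) (L : List ℕ) : KK n :=
  (-1 : KK n) ^ L.length * cElem n L 1 *
    algebraMap (MvPolynomial (Fin n) ℂ) (KK n) (prodPosRoots n)

/-- The first column `𝒞₁ = {ε₁ - ε_j, ε₁ + ε_j : 2 ≤ j ≤ n}` of `Φ⁺`, as a set of
linear polynomials (`ε_j` is the variable `X (j-1)`). -/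
def col1Set (n : ℕ) : Set (MvPolynomial (Fin n) ℂ) :=
  {p | ∃ i j : Fin n, (i : ℕ) = 0 ∧ 0 < (j : ℕ) ∧ (p = X i - X j ∨ p = X i + X j)}

/-- The support of an involution `w`, as a set of linear polynomials: it contains
`ε_i - ε_j` whenever `1 ≤ i < j ≤ n` and `w(i) = j`, and `ε_i + ε_j` whenever
`1 ≤ i < j ≤ n` and `w(i) = -j`. -/
def suppPoly (n : ℕ) (w : Equiv.Perm ℤ) : Set (MvPolynomial (Fin n) ℂ) :=
  {p | ∃ i j : Fin n, i < j ∧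
    ((w (((i : ℕ) : ℤ) + 1) = ((j : ℕ) : ℤ) + 1 ∧ p = X i - X j) ∨
     (w (((i : ℕ) : ℤ) + 1) = -(((j : ℕ) : ℤ) + 1) ∧ p = X i + X j))}

/-- The signed indices `a`, `b` define a root `ε_a + ε_b` of `Dₙ`. -/
def IsRootPair (n : ℕ) (a b : ℤ) : Prop :=
  1 ≤ |a| ∧ |a| ≤ n ∧ 1 ≤ |b| ∧ |b| ≤ n ∧ |a| ≠ |b|

/-- The reflection in the root `ε_a + ε_b`. -/
def rootRefl (a b : ℤ) : Equiv.Perm ℤ := Equiv.swap a (-b) * Equiv.swap (-a) b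

/-- The signed indices `(a, b)` of the simple root `αᵢ = ε_a + ε_b`. -/
def simplePair (n i : ℕ) : ℤ × ℤ := if i < n then (i, -((i : ℤ) + 1)) else ((n : ℤ) - 1, n)

lemma simpleRefl_eq_rootRefl (n i : ℕ) :
    simpleRefl n i = rootRefl (simplePair n i).1 (simplePair n i).2 := by
  unfold simpleRefl rootRefl simplePair
  split_ifs <;> simp

lemma isRootPair_simplePair {n i : ℕ} (hn : 2 ≤ n) (hi : 1 ≤ i) :
    IsRootPair n (simplePair n i).1 (simplePair n i).2 := by
  unfold IsRootPair simplePair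
  split_ifs <;> grind

lemma IsRootPair.symm {n : ℕ} {a b : ℤ} (h : IsRootPair n a b) : IsRootPair n b a :=
  ⟨h.2.2.1, h.2.2.2.1, h.1, h.2.1, h.2.2.2.2.symm⟩

lemma IsRootPair.neg {n : ℕ} {a b : ℤ} (h : IsRootPair n a b) : IsRootPair n (-a) (-b) := by
  simpa [IsRootPair] using h

lemma rootRefl_apply {n : ℕ} {a b : ℤ} (h : IsRootPair n a b) (k : ℤ) :
    rootRefl a b k =
      if k = a then -b else if k = -b then a else if k = -a then b else if k = b then -a else k := by
  unfold rootRefl IsRootPair at *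
  simp only [Equiv.Perm.mul_apply, Equiv.swap_apply_def]
  grind

lemma rootRefl_neg {n : ℕ} {a b : ℤ} (h : IsRootPair n a b) (k : ℤ) :
    rootRefl a b (-k) = -rootRefl a b k := by
  simp only [rootRefl_apply h]
  unfold IsRootPair at h
  grind

lemma rootRefl_mul_self {n : ℕ} {a b : ℤ} (h : IsRootPair n a b) :
    rootRefl a b * rootRefl a b = 1 := by
  ext k
  simp only [Equiv.Perm.mul_apply, rootRefl_apply h, Equiv.Perm.one_apply]
  unfold IsRootPair at h
  grind

lemma rootRefl_symm {n : ℕ} {a b : ℤ} (h : IsRootPair n a b) : rootRefl b a = rootRefl a b := by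
  ext k
  simp only [rootRefl_apply h, rootRefl_apply h.symm]
  unfold IsRootPair at h
  grind

lemma rootRefl_neg_neg {n : ℕ} {a b : ℤ} (h : IsRootPair n a b) :
    rootRefl (-a) (-b) = rootRefl a b := by
  ext k
  simp only [rootRefl_apply h, rootRefl_apply h.neg]
  unfold IsRootPair at h
  grind

lemma IsRootPair.rootRefl {n : ℕ} {a b c d : ℤ} (h : IsRootPair n a b) (h' : IsRootPair n c d) :
    IsRootPair n (rootRefl a b c) (rootRefl a b d) := by
  simp only [rootRefl_apply h]
  unfold IsRootPair at *
  grind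

lemma mul_rootRefl {s : Equiv.Perm ℤ} (hs : ∀ k, s (-k) = -s k) (a b : ℤ) :
    s * rootRefl a b = rootRefl (s a) (s b) * s := by
  unfold rootRefl
  rw [← mul_assoc, Equiv.mul_swap_eq_swap_mul s, hs, mul_assoc, Equiv.mul_swap_eq_swap_mul s, hs,
    mul_assoc]

lemma simpleRefl_neg {n i : ℕ} (hn : 2 ≤ n) (hi : 1 ≤ i) (k : ℤ) :
    simpleRefl n i (-k) = -simpleRefl n i k := by
  rw [simpleRefl_eq_rootRefl, rootRefl_neg (isRootPair_simplePair hn hi)]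

/-- The root `ε_a + ε_b` is positive. -/
def IsPosPair (a b : ℤ) : Prop := (|a| < |b| ∧ 0 < a) ∨ (|b| < |a| ∧ 0 < b)

/-- A simple reflection makes only its own simple root negative. -/
lemma eq_simplePair_of_isPosPair {n i : ℕ} {a b : ℤ} (hn : 2 ≤ n) (hi : 1 ≤ i ∧ i ≤ n)
    (h : IsRootPair n a b) (hp : IsPosPair a b)
    (hneg : ¬ IsPosPair (simpleRefl n i a) (simpleRefl n i b)) :
    (a, b) = simplePair n i ∨ (b, a) = simplePair n i := by
  have h' := isRootPair_simplePair hn hi.1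
  rw [simpleRefl_eq_rootRefl, rootRefl_apply h', rootRefl_apply h'] at hneg
  unfold IsPosPair IsRootPair at *
  unfold simplePair at *
  simp only [Prod.ext_iff]
  split_ifs at * <;> simp only at * <;> grind

lemma wordProd_cons (n i : ℕ) (L : List ℕ) :
    wordProd n (i :: L) = simpleRefl n i * wordProd n L := by
  simp [wordProd]

lemma wordProd_append (n : ℕ) (L M : List ℕ) :
    wordProd n (L ++ M) = wordProd n L * wordProd n M := by
  simp [wordProd]

lemma IsWord.cons_iff {n i : ℕ} {L : List ℕ} :
    IsWord n (i :: L) ↔ (1 ≤ i ∧ i ≤ n) ∧ IsWord n L := by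
  simp [IsWord]

lemma wordProd_neg {n : ℕ} (hn : 2 ≤ n) {L : List ℕ} (hL : IsWord n L) (k : ℤ) :
    wordProd n L (-k) = -wordProd n L k := by
  induction L with
  | nil => simp [wordProd]
  | cons i L ih =>
    rw [IsWord.cons_iff] at hL
    simp [wordProd_cons, ih hL.2, simpleRefl_neg hn hL.1.1]

lemma IsRootPair.wordProd {n : ℕ} (hn : 2 ≤ n) {L : List ℕ} (hL : IsWord n L) {a b : ℤ}
    (h : IsRootPair n a b) : IsRootPair n (wordProd n L a) (wordProd n L b) := by
  induction L with
  | nil => simpa [_root_.wordProd] using h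
  | cons i L ih =>
    rw [IsWord.cons_iff] at hL
    simpa [wordProd_cons, simpleRefl_eq_rootRefl] using
      (isRootPair_simplePair hn hL.1.1).rootRefl (ih hL.2)

/-- The strong exchange property: if a word makes a positive root negative, then deleting a
letter multiplies the product by the corresponding reflection. -/
lemma exists_word_mul_rootRefl {n : ℕ} (hn : 2 ≤ n) {L : List ℕ} (hL : IsWord n L) {a b : ℤ}
    (h : IsRootPair n a b) (hp : IsPosPair a b)
    (hneg : ¬ IsPosPair (wordProd n L a) (wordProd n L b)) :
    ∃ M, IsWord n M ∧ M.length + 1 = L.length ∧ wordProd n M = wordProd n L * rootRefl a b := by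
  induction L with
  | nil => exact absurd hp (by simpa [wordProd] using hneg)
  | cons i L ih =>
    rw [IsWord.cons_iff] at hL
    by_cases hneg' : IsPosPair (wordProd n L a) (wordProd n L b)
    · refine ⟨L, hL.2, rfl, ?_⟩
      have hr := h.wordProd hn hL.2
      have key : simpleRefl n i = rootRefl (wordProd n L a) (wordProd n L b) := by
        rw [simpleRefl_eq_rootRefl]
        rcases eq_simplePair_of_isPosPair hn hL.1 hr hneg' hneg with h1 | h1 <;> rw [← h1]
        exact rootRefl_symm hr
      rw [wordProd_cons, key, ← mul_rootRefl (wordProd_neg hn hL.2), mul_assoc,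
        rootRefl_mul_self h, mul_one]
    · obtain ⟨M, hM, hlen, hprod⟩ := ih hL.2 hneg'
      refine ⟨i :: M, IsWord.cons_iff.2 ⟨hL.1, hM⟩, by simp [hlen], ?_⟩
      rw [wordProd_cons, wordProd_cons, hprod, mul_assoc]

lemma simpleRefl_apply_one {n i : ℕ} (hn : 3 ≤ n) (hi : 2 ≤ i) : simpleRefl n i 1 = 1 := by
  have h' := isRootPair_simplePair (n := n) (by omega) (show 1 ≤ i by omega)
  rw [simpleRefl_eq_rootRefl, rootRefl_apply h']
  unfold simplePair
  split_ifs <;> grind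

lemma wordProd_apply_one {n : ℕ} (hn : 3 ≤ n) {L : List ℕ} (hL : ∀ i ∈ L, 2 ≤ i) :
    wordProd n L 1 = 1 := by
  induction L with
  | nil => simp [wordProd]
  | cons i L ih =>
    rw [wordProd_cons, Equiv.Perm.mul_apply, ih fun j hj => hL j (by simp [hj]),
      simpleRefl_apply_one hn (hL i (by simp))]

lemma List.exists_eq_append_cons_notMem {α : Type*} {a : α} {L : List α} (h : a ∈ L) :
    ∃ U V, L = U ++ a :: V ∧ a ∉ V := by
  obtain ⟨V, U, hL, hV⟩ := List.eq_append_cons_of_mem (List.mem_reverse.2 h)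
  exact ⟨U.reverse, V.reverse, by rw [← L.reverse_reverse, hL]; simp, by simpa using hV⟩

/-- The reduced words of an element fixing `1` avoid the letter `1`. -/
lemma IsReducedWord.two_le {n : ℕ} (hn : 3 ≤ n) {w : Equiv.Perm ℤ} {L : List ℕ}
    (hL : IsReducedWord n w L) (hw : w 1 = 1) : ∀ i ∈ L, 2 ≤ i := by
  obtain ⟨hword, hprod, hlen⟩ := hL
  suffices h1 : 1 ∉ L by
    intro i hi
    have := hword i hi
    have : i ≠ 1 := by rintro rfl; exact h1 hi
    omega
  intro h1
  obtain ⟨U, V, rfl, hV⟩ := List.exists_eq_append_cons_notMem h1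
  have hU : IsWord n U := fun i hi => hword i (by simp [hi])
  have hVw : IsWord n V := fun i hi => hword i (by simp [hi])
  have hV1 : wordProd n V 1 = 1 := wordProd_apply_one hn fun i hi => by
    have := hVw i hi
    have : i ≠ 1 := by rintro rfl; exact hV hi
    omega
  have hpair : simplePair n 1 = (1, -2) := by
    unfold simplePair
    rw [if_pos (by omega)]
    norm_num
  have hroot : IsRootPair n 1 (-2) := by unfold IsRootPair; grind
  have hs1 : simpleRefl n 1 = rootRefl 1 (-2) := by rw [simpleRefl_eq_rootRefl, hpair]
  have hU2 : wordProd n U 2 = 1 := by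
    have := hw
    rw [← hprod, wordProd_append, wordProd_cons] at this
    simpa [hV1, hs1, rootRefl_apply hroot] using this
  obtain ⟨M, hM, hMlen, hMprod⟩ := exists_word_mul_rootRefl (by omega) hU hroot
    (by simp [IsPosPair]) (by
      have := hroot.wordProd (by omega) hU
      rw [wordProd_neg (by omega) hU, hU2] at this ⊢
      unfold IsPosPair IsRootPair at *
      grind)
  have hle : weylLength n w ≤ (M ++ V).length := by
    refine Nat.sInf_le ⟨M ++ V, ?_, rfl, ?_⟩
    · intro i hi
      rcases List.mem_append.1 hi with h | h
      exacts [hM i h, hVw i h]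
    · rw [← hprod, wordProd_append, wordProd_append, wordProd_cons, hMprod, hs1, mul_assoc]
  simp only [List.length_append, List.length_cons] at hlen hle
  omega

/-- The root `ε_a + ε_b` as a linear polynomial. -/
noncomputable def rootPoly (n : ℕ) (a b : ℤ) : MvPolynomial (Fin n) ℂ := epsPoly n a + epsPoly n b

lemma epsPoly_neg (n : ℕ) (k : ℤ) : epsPoly n (-k) = -epsPoly n k := by
  unfold epsPoly
  split_ifs <;> first | omega | simp

lemma epsPoly_succ {n : ℕ} (i : Fin n) : epsPoly n ((i : ℕ) + 1) = X i := by
  unfold epsPoly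
  rw [dif_pos (by omega)]
  congr
  simp

lemma exists_epsPoly_eq {n : ℕ} {k : ℤ} (h : 1 ≤ |k|) (h' : |k| ≤ n) :
    ∃ i : Fin n, k = (i : ℕ) + 1 ∨ k = -((i : ℕ) + 1) := by
  refine ⟨⟨(|k| - 1).toNat, by omega⟩, ?_⟩
  simp only
  grind

lemma rootPoly_comm (n : ℕ) (a b : ℤ) : rootPoly n a b = rootPoly n b a := add_comm _ _

lemma rootPoly_neg_neg (n : ℕ) (a b : ℤ) : rootPoly n (-a) (-b) = -rootPoly n a b := by
  simp only [rootPoly, epsPoly_neg]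
  ring

lemma simpleRootPoly_eq_rootPoly (n i : ℕ) :
    simpleRootPoly n i = rootPoly n (simplePair n i).1 (simplePair n i).2 := by
  unfold simpleRootPoly rootPoly simplePair
  split_ifs
  · simp only [epsPoly_neg, sub_eq_add_neg]
  · rfl

lemma polyAct_epsPoly {n : ℕ} {s : Equiv.Perm ℤ} (hs : ∀ k, s (-k) = -s k) {k : ℤ}
    (h : 1 ≤ |k|) (h' : |k| ≤ n) : polyAct n s (epsPoly n k) = epsPoly n (s k) := by
  obtain ⟨i, rfl | rfl⟩ := exists_epsPoly_eq h h'
  · rw [epsPoly_succ]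
    simp [polyAct]
  · rw [epsPoly_neg, epsPoly_succ, hs, epsPoly_neg, map_neg]
    simp [polyAct]

lemma polyAct_rootPoly {n : ℕ} {s : Equiv.Perm ℤ} (hs : ∀ k, s (-k) = -s k) {a b : ℤ}
    (h : IsRootPair n a b) : polyAct n s (rootPoly n a b) = rootPoly n (s a) (s b) := by
  rw [rootPoly, map_add, polyAct_epsPoly hs h.1 h.2.1, polyAct_epsPoly hs h.2.2.1 h.2.2.2.1,
    rootPoly]

lemma polyAct_one (n : ℕ) (p : MvPolynomial (Fin n) ℂ) : polyAct n 1 p = p := by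
  have : polyAct n 1 = AlgHom.id ℂ _ := by
    ext i : 1
    simp [polyAct, epsPoly_succ]
  simp [this]

lemma polyAct_mul {n : ℕ} {u v : Equiv.Perm ℤ} (hu : ∀ k, u (-k) = -u k) (hv' : ∀ k, v (-k) = -v k)
    (hv : ∀ k : ℤ, 1 ≤ |k| → |k| ≤ n → 1 ≤ |v k| ∧ |v k| ≤ n) (p : MvPolynomial (Fin n) ℂ) :
    polyAct n (u * v) p = polyAct n u (polyAct n v p) := by
  have : polyAct n (u * v) = (polyAct n u).comp (polyAct n v) := by
    ext i : 1
    have h := hv (((i : ℕ) : ℤ) + 1) (by grind) (by have := i.2; grind)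
    rw [AlgHom.comp_apply, ← epsPoly_succ, polyAct_epsPoly hv' (by grind) (by have := i.2; grind),
      polyAct_epsPoly hu h.1 h.2, polyAct_epsPoly (fun k => by simp [hu, hv']) (by grind)
      (by have := i.2; grind), Equiv.Perm.mul_apply]
  simp [this]

lemma rootRefl_abs {n : ℕ} {a b : ℤ} (h : IsRootPair n a b) (k : ℤ) (h1 : 1 ≤ |k|)
    (h2 : |k| ≤ n) : 1 ≤ |rootRefl a b k| ∧ |rootRefl a b k| ≤ n := by
  rw [rootRefl_apply h]
  unfold IsRootPair at h
  grind

lemma polyAct_rootRefl_self {n : ℕ} {a b : ℤ} (h : IsRootPair n a b)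
    (p : MvPolynomial (Fin n) ℂ) :
    polyAct n (rootRefl a b) (polyAct n (rootRefl a b) p) = p := by
  rw [← polyAct_mul (rootRefl_neg h) (rootRefl_neg h) (rootRefl_abs h), rootRefl_mul_self h, polyAct_one]

/-- A reflection acts trivially modulo its root. -/
lemma rootPoly_dvd_sub_polyAct {n : ℕ} {a b : ℤ} (h : IsRootPair n a b)
    (p : MvPolynomial (Fin n) ℂ) : rootPoly n a b ∣ p - polyAct n (rootRefl a b) p := by
  induction p using MvPolynomial.induction_on with
  | C c => simp [polyAct, algHom_C]
  | add p q hp hq =>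
    rw [map_add]
    convert dvd_add hp hq using 1
    ring
  | mul_X p i hp =>
    have hX : rootPoly n a b ∣ X i - polyAct n (rootRefl a b) (X i) := by
      have hab := h
      unfold IsRootPair at h
      rw [← epsPoly_succ, polyAct_epsPoly (rootRefl_neg hab) (by grind) (by have := i.2; grind),
        rootRefl_apply hab]
      split_ifs with h1 h2 h3 h4
      · rw [h1, epsPoly_neg, rootPoly, sub_neg_eq_add]
      · rw [h2, epsPoly_neg, rootPoly]
        exact ⟨-1, by ring⟩
      · rw [h3, epsPoly_neg, rootPoly]
        exact ⟨-1, by ring⟩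
      · rw [h4, epsPoly_neg, rootPoly]
        exact ⟨1, by ring⟩
      · simp
    rw [map_mul]
    convert dvd_add (hp.mul_right (polyAct n (rootRefl a b) (X i))) (hX.mul_left p) using 1
    ring

lemma irreducible_X_add {n : ℕ} {i j : Fin n} (hij : i ≠ j) (c : ℂ) :
    Irreducible (X i + C c * X j : MvPolynomial (Fin n) ℂ) := by
  have := MvPolynomial.irreducible_mul_X_add (1 : MvPolynomial (Fin n) ℂ) (C c * X j) i one_ne_zero
    (by simp) (fun h => by
      have := vars_mul _ _ h
      simp [hij] at this) isRelPrime_one_left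
  simpa using this

lemma prime_rootPoly {n : ℕ} {a b : ℤ} (h : IsRootPair n a b) : Prime (rootPoly n a b) := by
  rw [← irreducible_iff_prime]
  obtain ⟨i, hi⟩ := exists_epsPoly_eq h.1 h.2.1
  obtain ⟨j, hj⟩ := exists_epsPoly_eq h.2.2.1 h.2.2.2.1
  have hij : i ≠ j := by
    rintro rfl
    unfold IsRootPair at h
    grind
  rcases hi with rfl | rfl <;> rcases hj with rfl | rfl <;>
    simp only [rootPoly, epsPoly_neg, epsPoly_succ]
  · simpa using irreducible_X_add hij 1
  · simpa using irreducible_X_add hij (-1)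
  · rw [← (Associated.refl _).neg_left.irreducible_iff]
    simpa [add_comm] using irreducible_X_add hij (-1)
  · rw [← (Associated.refl _).neg_left.irreducible_iff]
    simpa [add_comm] using irreducible_X_add hij 1

/-- The only roots divisible by a root are its multiples by `±1`. -/
lemma IsRootPair.eq_of_dvd {n : ℕ} {a b c d : ℤ} (h : IsRootPair n a b) (h' : IsRootPair n c d)
    (hdvd : rootPoly n a b ∣ rootPoly n c d) :
    (c = a ∧ d = b) ∨ (c = b ∧ d = a) ∨ (c = -a ∧ d = -b) ∨ (c = -b ∧ d = -a) := by
  let y : ℤ → ℤ := fun k =>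
    if k = a ∨ k = -b then n + 1 else if k = -a ∨ k = b then -(n + 1) else k
  have hy : ∀ k : ℤ, y (-k) = -y k := by
    unfold IsRootPair at h
    intro k
    simp only [y]
    grind
  let x : Fin n → ℂ := fun i => (y ((i : ℕ) + 1) : ℂ)
  have hx : ∀ k : ℤ, 1 ≤ |k| → |k| ≤ n → eval x (epsPoly n k) = (y k : ℂ) := by
    intro k h1 h2
    obtain ⟨i, rfl | rfl⟩ := exists_epsPoly_eq h1 h2
    · simp [epsPoly_succ, x]
    · rw [epsPoly_neg, hy, epsPoly_succ]
      simp [x]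
  have h0 : y c + y d = 0 := by
    have := map_dvd (eval x) hdvd
    rw [rootPoly, rootPoly, map_add, map_add, hx _ h.1 h.2.1, hx _ h.2.2.1 h.2.2.2.1,
      hx _ h'.1 h'.2.1, hx _ h'.2.2.1 h'.2.2.2.1] at this
    have hab : y a + y b = 0 := by
      unfold IsRootPair at h
      simp only [y]
      grind
    norm_cast at this
    rw [hab, Int.cast_zero, zero_dvd_iff] at this
    exact_mod_cast this
  clear hx hy hdvd
  unfold IsRootPair at *
  simp only [y] at h0
  clear x y
  split_ifs at h0 <;> grind

lemma simpleRefl_abs {n i : ℕ} (hn : 2 ≤ n) (hi : 1 ≤ i) (k : ℤ) (h1 : 1 ≤ |k|)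
    (h2 : |k| ≤ n) : 1 ≤ |simpleRefl n i k| ∧ |simpleRefl n i k| ≤ n := by
  rw [simpleRefl_eq_rootRefl]
  exact rootRefl_abs (isRootPair_simplePair hn hi) k h1 h2

lemma rootPoly_dvd_prodPosRoots {n : ℕ} {a b : ℤ} (h : IsRootPair n a b) :
    rootPoly n a b ∣ prodPosRoots n := by
  wlog hlt : |a| < |b| generalizing a b
  · rw [rootPoly_comm]
    exact this h.symm (lt_of_le_of_ne (not_lt.1 hlt) h.2.2.2.2.symm)
  obtain ⟨i, hi⟩ := exists_epsPoly_eq h.1 h.2.1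
  obtain ⟨j, hj⟩ := exists_epsPoly_eq h.2.2.1 h.2.2.2.1
  have hij : i < j := by
    rw [Fin.lt_def]
    unfold IsRootPair at h
    grind
  have key : (X i - X j) * (X i + X j) ∣ prodPosRoots n :=
    Finset.dvd_prod_of_mem (fun p : Fin n × Fin n =>
      ((X p.1 - X p.2) * (X p.1 + X p.2) : MvPolynomial (Fin n) ℂ)) (a := (i, j)) (by simpa using hij)
  refine dvd_trans ?_ key
  rcases hi with rfl | rfl <;> rcases hj with rfl | rfl <;>
    simp only [rootPoly, epsPoly_neg, epsPoly_succ]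
  · exact dvd_mul_left _ _
  · exact ⟨X i + X j, by ring⟩
  · exact ⟨-(X i + X j), by ring⟩
  · exact ⟨-(X i - X j), by ring⟩

/-- The rational function `f` has no pole along `β`. -/
def IsRegularAt {n : ℕ} (β : MvPolynomial (Fin n) ℂ) (f : KK n) : Prop :=
  ∃ a b : MvPolynomial (Fin n) ℂ, ¬ β ∣ b ∧
    f * algebraMap (MvPolynomial (Fin n) ℂ) (KK n) b = algebraMap (MvPolynomial (Fin n) ℂ) (KK n) a

section IsRegularAt

variable {n : ℕ} {β : MvPolynomial (Fin n) ℂ} {f g : KK n}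

lemma algebraMap_KK_ne_zero {p : MvPolynomial (Fin n) ℂ} (hp : p ≠ 0) :
    algebraMap (MvPolynomial (Fin n) ℂ) (KK n) p ≠ 0 := by
  simpa using hp

lemma isRegularAt_algebraMap (hβ : Prime β) (p : MvPolynomial (Fin n) ℂ) :
    IsRegularAt β (algebraMap (MvPolynomial (Fin n) ℂ) (KK n) p) :=
  ⟨p, 1, fun h => hβ.not_isUnit (isUnit_of_dvd_one h), by simp⟩

lemma IsRegularAt.add (hβ : Prime β) (hf : IsRegularAt β f) (hg : IsRegularAt β g) :
    IsRegularAt β (f + g) := by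
  obtain ⟨a, b, hb, hab⟩ := hf
  obtain ⟨c, d, hd, hcd⟩ := hg
  refine ⟨a * d + c * b, b * d, fun h => (hβ.dvd_or_dvd h).elim hb hd, ?_⟩
  simp only [map_add, map_mul, ← hab, ← hcd]
  ring

lemma IsRegularAt.mul (hβ : Prime β) (hf : IsRegularAt β f) (hg : IsRegularAt β g) :
    IsRegularAt β (f * g) := by
  obtain ⟨a, b, hb, hab⟩ := hf
  obtain ⟨c, d, hd, hcd⟩ := hg
  refine ⟨a * c, b * d, fun h => (hβ.dvd_or_dvd h).elim hb hd, ?_⟩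
  simp only [map_mul, ← hab, ← hcd]
  ring

lemma IsRegularAt.neg (hf : IsRegularAt β f) : IsRegularAt β (-f) := by
  obtain ⟨a, b, hb, hab⟩ := hf
  exact ⟨-a, b, hb, by rw [map_neg, ← hab, neg_mul]⟩

lemma IsRegularAt.sub (hβ : Prime β) (hf : IsRegularAt β f) (hg : IsRegularAt β g) :
    IsRegularAt β (f - g) := by
  rw [sub_eq_add_neg]
  exact hf.add hβ hg.neg

lemma isRegularAt_inv {p : MvPolynomial (Fin n) ℂ} (hp : ¬ β ∣ p) :
    IsRegularAt β (algebraMap (MvPolynomial (Fin n) ℂ) (KK n) p)⁻¹ := by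
  refine ⟨1, p, hp, ?_⟩
  rw [map_one, inv_mul_cancel₀ (algebraMap_KK_ne_zero (by rintro rfl; exact hp (dvd_zero _)))]

lemma IsRegularAt.of_associated {γ : MvPolynomial (Fin n) ℂ} (h : Associated β γ)
    (hf : IsRegularAt β f) : IsRegularAt γ f := by
  obtain ⟨a, b, hb, hab⟩ := hf
  exact ⟨a, b, fun hd => hb (h.dvd.trans hd), hab⟩

/-- A rational function without poles is a polynomial. -/
lemma exists_eq_algebraMap_of_isRegularAt (h : ∀ β, Prime β → IsRegularAt β f) :
    ∃ p, f = algebraMap (MvPolynomial (Fin n) ℂ) (KK n) p := by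
  obtain ⟨a, b, hrel, hab⟩ := IsFractionRing.exists_reduced_fraction (MvPolynomial (Fin n) ℂ) f
  have hb0 := nonZeroDivisors.ne_zero b.2
  have hfb : f * algebraMap _ (KK n) (b : MvPolynomial (Fin n) ℂ) = algebraMap _ _ a := by
    rw [← hab, IsLocalization.mk'_spec]
  by_cases hb : IsUnit (b : MvPolynomial (Fin n) ℂ)
  · obtain ⟨c, hc⟩ := hb.exists_right_inv
    refine ⟨a * c, ?_⟩
    rw [map_mul, ← hfb, mul_assoc, ← map_mul, hc, map_one, mul_one]
  · obtain ⟨β, hβ, hβb⟩ := WfDvdMonoid.exists_irreducible_factor hb hb0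
    have hβ' := irreducible_iff_prime.1 hβ
    obtain ⟨c, d, hd, hcd⟩ := h β hβ'
    have key : a * d = b * c := by
      apply IsFractionRing.injective (MvPolynomial (Fin n) ℂ) (KK n)
      rw [map_mul, map_mul, ← hfb, ← hcd]
      ring
    have : β ∣ a * d := key ▸ hβb.mul_right c
    exact absurd (hrel ((hβ'.dvd_or_dvd this).resolve_right hd) hβb) hβ.not_isUnit

end IsRegularAt

/-- A reflection acting on polynomials, as an automorphism. -/
noncomputable def rootReflEquiv {n : ℕ} {a b : ℤ} (h : IsRootPair n a b) :
    MvPolynomial (Fin n) ℂ ≃+* MvPolynomial (Fin n) ℂ :=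
  RingEquiv.ofRingHom (polyAct n (rootRefl a b) : _ →+* _) (polyAct n (rootRefl a b) : _ →+* _)
    (RingHom.ext fun p => polyAct_rootRefl_self h p)
    (RingHom.ext fun p => polyAct_rootRefl_self h p)

/-- A reflection acting on rational functions. -/
noncomputable def fracRefl {n : ℕ} {a b : ℤ} (h : IsRootPair n a b) : KK n →+* KK n :=
  (IsFractionRing.ringEquivOfRingEquiv (rootReflEquiv h) : KK n ≃+* KK n)

lemma fracRefl_algebraMap {n : ℕ} {a b : ℤ} (h : IsRootPair n a b) (p : MvPolynomial (Fin n) ℂ) :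
    fracRefl h (algebraMap _ _ p) = algebraMap _ _ (polyAct n (rootRefl a b) p) :=
  IsFractionRing.ringEquivOfRingEquiv_algebraMap (rootReflEquiv h) p

lemma IsRegularAt.fracRefl {n : ℕ} {a b : ℤ} (h : IsRootPair n a b) {β : MvPolynomial (Fin n) ℂ}
    {f : KK n} (hf : IsRegularAt (polyAct n (rootRefl a b) β) f) :
    IsRegularAt β (fracRefl h f) := by
  obtain ⟨p, q, hq, hpq⟩ := hf
  refine ⟨polyAct n (rootRefl a b) p, polyAct n (rootRefl a b) q, fun hd => hq ?_, ?_⟩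
  · simpa [polyAct_rootRefl_self h] using map_dvd (polyAct n (rootRefl a b)) hd
  · rw [← fracRefl_algebraMap h, ← fracRefl_algebraMap h, ← map_mul, hpq]

lemma prime_polyAct_rootRefl {n : ℕ} {a b : ℤ} (h : IsRootPair n a b)
    {β : MvPolynomial (Fin n) ℂ} (hβ : Prime β) : Prime (polyAct n (rootRefl a b) β) :=
  (MulEquiv.prime_iff (rootReflEquiv h).toMulEquiv).2 hβ

lemma polyAct_rootRefl_rootPoly {n : ℕ} {a b : ℤ} (h : IsRootPair n a b) :
    polyAct n (rootRefl a b) (rootPoly n a b) = -rootPoly n a b := by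
  rw [polyAct_rootPoly (rootRefl_neg h) h, rootRefl_apply h, rootRefl_apply h,
    ← rootPoly_neg_neg, rootPoly_comm]
  unfold IsRootPair at h
  congr 1 <;> grind

/-- The divided difference of a function regular along the root is regular along the root. -/
lemma IsRegularAt.dividedDifference {n : ℕ} {a b : ℤ} (h : IsRootPair n a b) {f : KK n}
    (hf : IsRegularAt (rootPoly n a b) f) :
    IsRegularAt (rootPoly n a b) ((algebraMap _ _ (rootPoly n a b))⁻¹ * (f - _root_.fracRefl h f)) := by
  have hβ := prime_rootPoly h
  obtain ⟨p, q, hq, hpq⟩ := hf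
  have hsq : ¬ rootPoly n a b ∣ polyAct n (rootRefl a b) q := fun hd => hq <|
    (dvd_iff_dvd_of_dvd_sub (rootPoly_dvd_sub_polyAct h q)).2 hd
  obtain ⟨c, hc⟩ := rootPoly_dvd_sub_polyAct h (p * polyAct n (rootRefl a b) q)
  refine ⟨c, q * polyAct n (rootRefl a b) q, fun hd => (hβ.dvd_or_dvd hd).elim hq hsq, ?_⟩
  have hspq := congrArg (_root_.fracRefl h) hpq
  rw [map_mul, fracRefl_algebraMap, fracRefl_algebraMap] at hspq
  have hne := algebraMap_KK_ne_zero hβ.ne_zero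
  rw [map_mul, polyAct_rootRefl_self h] at hc
  have hc' := congrArg (algebraMap _ (KK n)) hc
  simp only [map_sub, map_mul, ← hpq, ← hspq] at hc'
  rw [mul_assoc, inv_mul_eq_iff_eq_mul₀ hne, ← hc', map_mul]
  ring

/-- A family of rational functions indexed by `W` has at most simple poles along the roots, and
the residues of the members at `v` and `s_β v` along a root `β` cancel. -/
def HasCancellingPoles (n : ℕ) (m : Equiv.Perm ℤ → KK n) : Prop :=
  ∀ a b, IsRootPair n a b → ∀ v,
    IsRegularAt (rootPoly n a b) (algebraMap _ _ (rootPoly n a b) * m v) ∧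
      IsRegularAt (rootPoly n a b) (m v + m (rootRefl a b * v))

/-- The effect on coefficient families of multiplying by a divided difference operator. -/
noncomputable def dividedFamily {n : ℕ} {c d : ℤ} (h : IsRootPair n c d)
    (m : Equiv.Perm ℤ → KK n) (v : Equiv.Perm ℤ) : KK n :=
  (algebraMap _ _ (rootPoly n c d))⁻¹ * (m v - fracRefl h (m (rootRefl c d * v)))

lemma HasCancellingPoles.dividedFamily_self {n : ℕ} {c d : ℤ} (h : IsRootPair n c d)
    {m : Equiv.Perm ℤ → KK n} (hm : HasCancellingPoles n m) (v : Equiv.Perm ℤ) :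
    IsRegularAt (rootPoly n c d) (algebraMap _ _ (rootPoly n c d) * dividedFamily h m v) ∧
      IsRegularAt (rootPoly n c d) (dividedFamily h m v + dividedFamily h m (rootRefl c d * v)) := by
  have hα := prime_rootPoly h
  have hne := algebraMap_KK_ne_zero hα.ne_zero
  obtain ⟨hr, hg⟩ := hm c d h v
  constructor
  · have hσg : IsRegularAt (rootPoly n c d) (fracRefl h (m v + m (rootRefl c d * v))) := by
      apply IsRegularAt.fracRefl
      rw [polyAct_rootRefl_rootPoly h]
      exact hg.of_associated (Associated.refl _).neg_right
    convert (hr.dividedDifference h).sub hα hσg using 1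
    rw [dividedFamily, map_add, map_mul, fracRefl_algebraMap, polyAct_rootRefl_rootPoly h, map_neg]
    field_simp
    ring
  · convert hg.dividedDifference h using 1
    rw [dividedFamily, dividedFamily, ← mul_assoc, rootRefl_mul_self h, one_mul, map_add]
    ring

lemma HasCancellingPoles.dividedFamily {n : ℕ} {c d : ℤ} (h : IsRootPair n c d)
    {m : Equiv.Perm ℤ → KK n} (hm : HasCancellingPoles n m) :
    HasCancellingPoles n (dividedFamily h m) := by
  intro a b hab v
  have hβ := prime_rootPoly hab
  by_cases hdvd : rootPoly n a b ∣ rootPoly n c d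
  · have hself := hm.dividedFamily_self h v
    rcases hab.eq_of_dvd h hdvd with ⟨rfl, rfl⟩ | ⟨rfl, rfl⟩ | ⟨rfl, rfl⟩ | ⟨rfl, rfl⟩
    · exact hself
    · rw [rootPoly_comm, rootRefl_symm h]
      exact hself
    · rw [rootRefl_neg_neg hab, rootPoly_neg_neg, map_neg, neg_mul] at hself
      have hassoc := (Associated.refl (rootPoly n a b)).neg_left
      exact ⟨by simpa using hself.1.neg.of_associated hassoc, hself.2.of_associated hassoc⟩
    · rw [rootRefl_neg_neg hab.symm, rootPoly_neg_neg, map_neg, neg_mul, rootPoly_comm,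
        rootRefl_symm hab] at hself
      have hassoc := (Associated.refl (rootPoly n a b)).neg_left
      exact ⟨by simpa using hself.1.neg.of_associated hassoc, hself.2.of_associated hassoc⟩
  · have hinv := isRegularAt_inv hdvd
    have hs := hm _ _ (h.rootRefl hab) (rootRefl c d * v)
    rw [← polyAct_rootPoly (rootRefl_neg h) hab, ← mul_assoc, ← mul_rootRefl (rootRefl_neg h)] at hs
    obtain ⟨hr, hg⟩ := hm a b hab v
    constructor
    · convert hinv.mul hβ (hr.sub hβ (hs.1.fracRefl h)) using 1
      rw [map_mul, fracRefl_algebraMap, polyAct_rootRefl_self h, _root_.dividedFamily]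
      ring
    · convert hinv.mul hβ (hg.sub hβ (hs.2.fracRefl h)) using 1
      rw [map_add, _root_.dividedFamily, _root_.dividedFamily, mul_assoc (rootRefl c d)]
      ring

/-- Extension of an exponent pattern by `0`. -/
def extendMask {l : ℕ} (E : Fin l → Bool) (m : ℕ) : Bool := if h : m < l then E ⟨m, h⟩ else false

lemma extendMask_cons_zero {l : ℕ} (b : Bool) (E : Fin l → Bool) :
    extendMask (Fin.cons b E : Fin (l + 1) → Bool) 0 = b := by
  simp [extendMask]

lemma extendMask_cons_succ {l : ℕ} (b : Bool) (E : Fin l → Bool) :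
    (fun m => extendMask (Fin.cons b E : Fin (l + 1) → Bool) (m + 1)) = extendMask E := by
  funext m
  simp only [extendMask, Nat.add_lt_add_iff_right]
  split_ifs with h
  · exact Fin.cons_succ (α := fun _ => Bool) b E ⟨m, h⟩
  · rfl

lemma maskedPrefix_cons (n i : ℕ) (L : List ℕ) (E : ℕ → Bool) (k : ℕ) :
    maskedPrefix n (i :: L) E (k + 1) =
      (if E 0 then simpleRefl n i else 1) * maskedPrefix n L (fun m => E (m + 1)) k := by
  simp [maskedPrefix, List.range_succ_eq_map, Function.comp_def]

lemma maskedPrefix_neg_abs {n : ℕ} (hn : 2 ≤ n) {L : List ℕ} (hL : IsWord n L) (E : ℕ → Bool)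
    {k : ℕ} (hk : k ≤ L.length) :
    (∀ z, maskedPrefix n L E k (-z) = -maskedPrefix n L E k z) ∧
      ∀ z : ℤ, 1 ≤ |z| → |z| ≤ n → 1 ≤ |maskedPrefix n L E k z| ∧ |maskedPrefix n L E k z| ≤ n := by
  induction L generalizing k E with
  | nil =>
    obtain rfl : k = 0 := by simpa using hk
    simp +contextual [maskedPrefix]
  | cons i L ih =>
    rw [IsWord.cons_iff] at hL
    cases k with
    | zero => simp +contextual [maskedPrefix]
    | succ k =>
      obtain ⟨h1, h2⟩ := ih hL.2 (fun m => E (m + 1)) (k := k) (by simpa using hk)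
      rw [maskedPrefix_cons]
      split_ifs
      · refine ⟨fun z => by simp [h1, simpleRefl_neg hn hL.1.1], fun z hz hz' => ?_⟩
        have := h2 z hz hz'
        exact simpleRefl_abs hn hL.1.1 _ this.1 this.2
      · simpa using ⟨h1, h2⟩

/-- The summand of `c_{w,v}` attached to an exponent pattern. -/
noncomputable def maskTerm (n : ℕ) (L : List ℕ) (E : ℕ → Bool) : KK n :=
  ∏ k ∈ Finset.range L.length,
    (algebraMap (MvPolynomial (Fin n) ℂ) (KK n)
      (polyAct n (maskedPrefix n L E (k + 1)) (simpleRootPoly n (L.getD k 0))))⁻¹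

open Classical in
/-- The element `c_{w,v}` without its sign. -/
noncomputable def maskSum (n : ℕ) (L : List ℕ) (v : Equiv.Perm ℤ) : KK n :=
  ∑ E : Fin L.length → Bool,
    if maskedPrefix n L (extendMask E) L.length = v then maskTerm n L (extendMask E) else 0

lemma dElem_eq_maskSum (n : ℕ) (L : List ℕ) :
    dElem n L = maskSum n L 1 * algebraMap _ _ (prodPosRoots n) := by
  have : cElem n L 1 = (-1) ^ L.length * maskSum n L 1 := rfl
  rw [dElem, this, ← mul_assoc, ← mul_pow]
  simp

open Classical in
lemma maskSum_nil (n : ℕ) (v : Equiv.Perm ℤ) : maskSum n [] v = if 1 = v then 1 else 0 := by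
  simp [maskSum, maskTerm, maskedPrefix]

lemma maskTerm_cons_false (n i : ℕ) (L : List ℕ) (E : Fin L.length → Bool) :
    maskTerm n (i :: L) (extendMask (Fin.cons false E : Fin (L.length + 1) → Bool)) =
      (algebraMap _ _ (simpleRootPoly n i))⁻¹ * maskTerm n L (extendMask E) := by
  rw [maskTerm, List.length_cons, Finset.prod_range_succ', mul_comm]
  simp only [maskedPrefix_cons, extendMask_cons_zero, extendMask_cons_succ]
  simp [maskTerm, maskedPrefix, polyAct_one]

lemma maskTerm_cons_true {n i : ℕ} (hn : 2 ≤ n) {L : List ℕ} (hL : IsWord n (i :: L))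
    (h : IsRootPair n (simplePair n i).1 (simplePair n i).2) (E : Fin L.length → Bool) :
    maskTerm n (i :: L) (extendMask (Fin.cons true E : Fin (L.length + 1) → Bool)) =
      -((algebraMap _ _ (simpleRootPoly n i))⁻¹ * fracRefl h (maskTerm n L (extendMask E))) := by
  rw [IsWord.cons_iff] at hL
  rw [maskTerm, List.length_cons, Finset.prod_range_succ', mul_comm, ← neg_mul]
  simp only [maskedPrefix_cons, extendMask_cons_zero, extendMask_cons_succ]
  congr 1
  · simp [maskedPrefix, simpleRootPoly_eq_rootPoly, simpleRefl_eq_rootRefl,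
      polyAct_rootRefl_rootPoly h]
    exact inv_neg
  · rw [maskTerm, map_prod]
    refine Finset.prod_congr rfl fun k hk => ?_
    obtain ⟨h1, h2⟩ := maskedPrefix_neg_abs hn hL.2 (extendMask E) (k := k + 1)
      (by simpa using hk)
    rw [map_inv₀, fracRefl_algebraMap, ← simpleRefl_eq_rootRefl,
      ← polyAct_mul (simpleRefl_neg hn hL.1.1) h1 h2]
    simp

lemma maskSum_cons {n i : ℕ} (hn : 2 ≤ n) {L : List ℕ} (hL : IsWord n (i :: L))
    (h : IsRootPair n (simplePair n i).1 (simplePair n i).2) :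
    maskSum n (i :: L) = dividedFamily h (maskSum n L) := by
  classical
  funext v
  have hs : ∀ u, simpleRefl n i * u = v ↔ u = rootRefl (simplePair n i).1 (simplePair n i).2 * v := by
    intro u
    rw [simpleRefl_eq_rootRefl]
    constructor
    · rintro rfl
      rw [← mul_assoc, rootRefl_mul_self h, one_mul]
    · rintro rfl
      rw [← mul_assoc, rootRefl_mul_self h, one_mul]
  have hsum : maskSum n (i :: L) v = ∑ p : Bool × (Fin L.length → Bool),
      if maskedPrefix n (i :: L) (extendMask (Fin.cons p.1 p.2 : Fin (L.length + 1) → Bool))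
        (L.length + 1) = v
      then maskTerm n (i :: L) (extendMask (Fin.cons p.1 p.2 : Fin (L.length + 1) → Bool))
      else 0 := by
    rw [maskSum]
    exact ((Fin.consEquiv fun _ : Fin (L.length + 1) => Bool).sum_comp fun E =>
      if maskedPrefix n (i :: L) (extendMask E) (L.length + 1) = v
      then maskTerm n (i :: L) (extendMask E) else 0).symm
  rw [hsum, Fintype.sum_prod_type, Fintype.sum_bool]
  simp only [maskedPrefix_cons, extendMask_cons_zero, extendMask_cons_succ, maskTerm_cons_false,
    maskTerm_cons_true hn hL h, if_true, one_mul, hs, Bool.false_eq_true, if_false]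
  rw [dividedFamily, ← simpleRootPoly_eq_rootPoly, mul_sub, maskSum, maskSum, map_sum,
    Finset.mul_sum, Finset.mul_sum, add_comm, sub_eq_add_neg, ← Finset.sum_neg_distrib]
  congr 1 <;> refine Finset.sum_congr rfl fun E _ => ?_ <;> split_ifs <;> simp

lemma hasCancellingPoles_maskSum {n : ℕ} (hn : 2 ≤ n) {L : List ℕ} (hL : IsWord n L) :
    HasCancellingPoles n (maskSum n L) := by
  induction L with
  | nil =>
    intro a b hab v
    have hβ := prime_rootPoly hab
    have hreg : ∀ v, IsRegularAt (rootPoly n a b) (maskSum n [] v) := fun v => by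
      rw [maskSum_nil]
      split_ifs
      · simpa using isRegularAt_algebraMap hβ 1
      · simpa using isRegularAt_algebraMap hβ 0
    exact ⟨(isRegularAt_algebraMap hβ _).mul hβ (hreg v), (hreg v).add hβ (hreg _)⟩
  | cons i L ih =>
    have hL' := IsWord.cons_iff.1 hL
    have h := isRootPair_simplePair hn hL'.1.1
    rw [maskSum_cons hn hL h]
    exact (ih hL'.2).dividedFamily h

/-- For a word in the letters `2, …, n`, the coefficients have no poles outside of the roots
not involving `ε₁`. -/
lemma isRegularAt_maskSum {n : ℕ} (hn : 3 ≤ n) {L : List ℕ} (hL : IsWord n L)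
    (hL2 : ∀ i ∈ L, 2 ≤ i) {β : MvPolynomial (Fin n) ℂ} (hβ : Prime β)
    (hroots : ∀ a b, IsRootPair n a b → 2 ≤ |a| → 2 ≤ |b| → ¬ β ∣ rootPoly n a b)
    (v : Equiv.Perm ℤ) : IsRegularAt β (maskSum n L v) := by
  induction L generalizing β v with
  | nil =>
    rw [maskSum_nil]
    split_ifs
    · simpa using isRegularAt_algebraMap hβ 1
    · simpa using isRegularAt_algebraMap hβ 0
  | cons i L ih =>
    have hL' := IsWord.cons_iff.1 hL
    have hi : 2 ≤ i := hL2 i (by simp)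
    have h := isRootPair_simplePair (n := n) (by omega) hL'.1.1
    have hpair : 2 ≤ |(simplePair n i).1| ∧ 2 ≤ |(simplePair n i).2| := by
      unfold simplePair
      split_ifs <;> grind
    have ih' := fun {β} => ih (β := β) hL'.2 fun j hj => hL2 j (by simp [hj])
    rw [maskSum_cons (by omega) hL h]
    refine (isRegularAt_inv (hroots _ _ h hpair.1 hpair.2)).mul hβ
      ((ih' hβ hroots v).sub hβ (IsRegularAt.fracRefl h (ih' (prime_polyAct_rootRefl h hβ) ?_ _)))
    intro a b hab ha hb hdvd
    have habs : ∀ k : ℤ, 2 ≤ |k| → 2 ≤ |rootRefl (simplePair n i).1 (simplePair n i).2 k| := by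
      intro k hk
      rw [rootRefl_apply h]
      split_ifs <;> simp [hpair.1, hpair.2, hk]
    have := map_dvd (polyAct n (rootRefl (simplePair n i).1 (simplePair n i).2)) hdvd
    rw [polyAct_rootRefl_self h, polyAct_rootPoly (rootRefl_neg h) hab] at this
    exact hroots _ _ (h.rootRefl hab) (habs a ha) (habs b hb) this

lemma IsBasicInvolution.apply_one {n : ℕ} (hn : 1 ≤ n) {w : Equiv.Perm ℤ}
    (hw : IsBasicInvolution n w) (hsupp : suppPoly n w ∩ col1Set n = ∅) : w 1 = 1 := by
  obtain ⟨⟨hodd, hfix, -⟩, -, hbasic⟩ := hw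
  have h0 : w 0 = 0 := by
    have := hodd 0
    rw [neg_zero] at this
    omega
  have hne0 : w 1 ≠ 0 := fun h => one_ne_zero (w.injective (h.trans h0.symm))
  have hne1 := hbasic 1 le_rfl (by omega)
  by_contra hne
  have hle : |w 1| ≤ n := by
    by_contra hlt
    exact hne (w.injective (hfix _ (not_le.1 hlt)))
  obtain ⟨j, hj⟩ := exists_epsPoly_eq (Int.one_le_abs hne0) hle
  obtain ⟨i, hi⟩ : ∃ i : Fin n, (i : ℕ) = 0 := ⟨⟨0, hn⟩, rfl⟩
  have hj0 : 0 < (j : ℕ) := by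
    refine Nat.pos_of_ne_zero fun h => ?_
    rw [h] at hj
    simp only [Nat.cast_zero, zero_add] at hj
    exact hj.elim hne hne1
  have hij : i < j := by rwa [Fin.lt_def, hi]
  have hw1 : w (((i : ℕ) : ℤ) + 1) = w 1 := by simp [hi]
  rw [← hw1] at hj
  suffices h : (suppPoly n w ∩ col1Set n).Nonempty by simp [hsupp] at h
  rcases hj with hj | hj
  · exact ⟨X i - X j, ⟨i, j, hij, Or.inl ⟨hj, rfl⟩⟩, ⟨i, j, hi, hj0, Or.inl rfl⟩⟩
  · exact ⟨X i + X j, ⟨i, j, hij, Or.inr ⟨hj, rfl⟩⟩, ⟨i, j, hi, hj0, Or.inr rfl⟩⟩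

lemma exists_rootPoly_eq_of_mem_col1Set {n : ℕ} {α : MvPolynomial (Fin n) ℂ} (hα : α ∈ col1Set n) :
    ∃ b, IsRootPair n 1 b ∧ α = rootPoly n 1 b := by
  obtain ⟨i, j, hi, hj, h⟩ := hα
  have hjn := j.2
  have hXi : (X i : MvPolynomial (Fin n) ℂ) = epsPoly n 1 := by
    rw [← epsPoly_succ, hi]
    simp
  rcases h with rfl | rfl
  · refine ⟨-((j : ℕ) + 1), ?_, by rw [rootPoly, epsPoly_neg, epsPoly_succ, hXi, sub_eq_add_neg]⟩
    unfold IsRootPair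
    grind
  · refine ⟨(j : ℕ) + 1, ?_, by rw [rootPoly, epsPoly_succ, hXi]⟩
    unfold IsRootPair
    grind

/-- Let `n ≥ 4` and let `w` be a basic involution in the Weyl group of
type `Dₙ` with `Supp(w) ∩ 𝒞₁ = ∅`. Then for every root `α ∈ 𝒞₁` the Kostant–Kumar
polynomial `d_w` is divisible by `α`: for every reduced decomposition `L` of `w` there is
a polynomial `g ∈ ℂ[x₁, …, xₙ]` with `d_w = α ⬝ g` in `ℂ(x₁, …, xₙ)`. -/
theorem statement0 (n : ℕ) (hn : 4 ≤ n) (w : Equiv.Perm ℤ)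
    (hw : IsBasicInvolution n w)
    (hsupp : suppPoly n w ∩ col1Set n = ∅) :
    ∀ α ∈ col1Set n, ∀ L : List ℕ, IsReducedWord n w L →
      ∃ g : MvPolynomial (Fin n) ℂ,
        dElem n L = algebraMap (MvPolynomial (Fin n) ℂ) (KK n) (α * g) := by
  intro α hα L hL
  obtain ⟨b, hb, rfl⟩ := exists_rootPoly_eq_of_mem_col1Set hα
  have hword := hL.1
  have hL2 := hL.two_le (by omega) (hw.apply_one (by omega) hsupp)
  obtain ⟨q, hq⟩ := rootPoly_dvd_prodPosRoots hb
  suffices h : ∀ β, Prime β → IsRegularAt β (maskSum n L 1 * algebraMap _ _ q) by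
    obtain ⟨g, hg⟩ := exists_eq_algebraMap_of_isRegularAt h
    refine ⟨g, ?_⟩
    rw [dElem_eq_maskSum, hq, map_mul, map_mul, ← hg]
    ring
  intro β hβ
  by_cases hroots : ∀ a b, IsRootPair n a b → 2 ≤ |a| → 2 ≤ |b| → ¬ β ∣ rootPoly n a b
  · exact (isRegularAt_maskSum (by omega) hword hL2 hβ hroots 1).mul hβ (isRegularAt_algebraMap hβ q)
  · push Not at hroots
    obtain ⟨c, d, hcd, hc, hd, hdvd⟩ := hroots
    have hγ := prime_rootPoly hcd
    obtain ⟨r, rfl⟩ : rootPoly n c d ∣ q := by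
      refine (hγ.dvd_or_dvd (hq ▸ rootPoly_dvd_prodPosRoots hcd)).resolve_left fun h => ?_
      have := hcd.eq_of_dvd hb h
      grind
    refine IsRegularAt.of_associated (hβ.associated_of_dvd hγ hdvd).symm ?_
    convert (hasCancellingPoles_maskSum (by omega) hword c d hcd 1).1.mul hγ
      (isRegularAt_algebraMap hγ r) using 1
    rw [map_mul]
    ring
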